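/- Let B ⊂ V be a connected finite subset and η: V → [0,1] with supp η ⊂ B and η ≡ 0 on the internal boundary of B. Let u ≥ 0 satisfy L u ≥ 0 on B, let φ: V → (0,∞), and set v := φ·u. Then there is an absolute constant c_{35} < ∞ such that for all α ≥ 1: E(η v^α) ≤ c_{35} α² ⟨ v^{2α}, Γ(η,η) − Γ_η(φ,φ^{−1}) ⟩_{ℓ²(V)}. -/

import Mathlib

open MeasureTheory Filter ENNReal Topology
open scoped Classical

namespace FPPPaper

/-! ## Basic geometry of `ℤ^d` -/

/-- Vertices of the lattice `ℤ^d`. -/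
abbrev Vert (d : ℕ) := Fin d → ℤ

/-- Nearest-neighbour adjacency on `ℤ^d`. -/
def adj {d : ℕ} (x y : Vert d) : Prop := (∑ i, (x i - y i).natAbs) = 1

/-- The `ℓ^∞`-distance on `ℤ^d`. -/
def linfDist {d : ℕ} (x y : Vert d) : ℕ := Finset.univ.sup fun i => (x i - y i).natAbs

/-- The `ℓ^1`-distance on `ℤ^d`. -/
def l1Dist {d : ℕ} (x y : Vert d) : ℕ := ∑ i, (x i - y i).natAbs

/-- The canonical embedding `ℤ^d → ℝ^d`. -/
def toRvec {d : ℕ} (x : Vert d) : Fin d → ℝ := fun i => (x i : ℝ)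

/-- `p` is a nearest-neighbour path from `x` to `y` (a list of consecutively
adjacent vertices starting at `x` and ending at `y`). -/
def IsPathFrom {d : ℕ} (x y : Vert d) (p : List (Vert d)) : Prop :=
  p.head? = some x ∧ p.getLast? = some y ∧ p.Chain' adj

/-- The (ordered) edges traversed by a path. -/
def edgesOf {d : ℕ} (p : List (Vert d)) : List (Vert d × Vert d) := p.zip p.tail

/-- Total weight of a path for edge weights `w`. -/
noncomputable def pathWeight {d : ℕ} (w : Vert d → Vert d → ℝ≥0∞) (p : List (Vert d)) :
    ℝ≥0∞ :=
  ((edgesOf p).map fun e => w e.1 e.2).sum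

/-- The first passage percolation (pseudo-)distance associated to edge weights `w`. -/
noncomputable def fppDist {d : ℕ} (w : Vert d → Vert d → ℝ≥0∞) (x y : Vert d) : ℝ≥0∞ :=
  ⨅ p : {p : List (Vert d) // IsPathFrom x y p}, pathWeight w p.1

/-- Total weight of a path for vertex weights `w`. -/
noncomputable def vertPathWeight {d : ℕ} (w : Vert d → ℝ≥0∞) (p : List (Vert d)) : ℝ≥0∞ :=
  (p.map w).sum

/-- The first passage percolation distance associated to vertex weights `w`. -/
noncomputable def vfppDist {d : ℕ} (w : Vert d → ℝ≥0∞) (x y : Vert d) : ℝ≥0∞ :=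
  ⨅ p : {p : List (Vert d) // IsPathFrom x y p}, vertPathWeight w p.1

/-- `x` and `y` are connected by a path all of whose edges belong to `S`. -/
def ConnectedIn {d : ℕ} (S : Set (Vert d × Vert d)) (x y : Vert d) : Prop :=
  ∃ p, IsPathFrom x y p ∧ ∀ e ∈ edgesOf p, e ∈ S

/-- `x` and `y` are connected by a path all of whose vertices belong to `S`. -/
def VConnectedIn {d : ℕ} (S : Set (Vert d)) (x y : Vert d) : Prop :=
  ∃ p, IsPathFrom x y p ∧ ∀ v ∈ p, v ∈ S

/-- The cube `Q(x,r) = {y : |x-y|_∞ ≤ r}`. -/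
def cubeVerts {d : ℕ} (x : Vert d) (r : ℝ) : Set (Vert d) :=
  {y | ∀ i, |(y i : ℝ) - (x i : ℝ)| ≤ r}

/-- The set of edges with weight zero. -/
def zeroSet {d : ℕ} (w : Vert d → Vert d → ℝ≥0∞) : Set (Vert d × Vert d) :=
  {e | adj e.1 e.2 ∧ w e.1 e.2 = 0}

/-! ## Configuration spaces indexed by vertices and edges -/

/-- Index set for configurations: vertices and (ordered) edges of `ℤ^d`. -/
abbrev Coord (d : ℕ) := Vert d ⊕ (Vert d × Vert d)

/-- The vertices underlying a coordinate. -/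
def coordVerts {d : ℕ} : Coord d → Set (Vert d)
  | Sum.inl v => {v}
  | Sum.inr e => {e.1, e.2}

/-- The configuration space `Ω = ∏_{e} Ω_e × ∏_x Ω_x` with all coordinate spaces
equal to `Γ`. -/
abbrev Config (d : ℕ) (Γ : Type*) := Coord d → Γ

/-- The lattice shift `τ_z` on configurations. -/
def shiftConfig {d : ℕ} {Γ : Type*} (z : Vert d) (ω : Config d Γ) : Config d Γ :=
  fun c => ω (match c with
    | Sum.inl v => Sum.inl (v + z)
    | Sum.inr e => Sum.inr (e.1 + z, e.2 + z))

/-- A function of the configuration is supported on the set `S` of coordinates. -/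
def SupportedOn {d : ℕ} {Γ β : Type*} (S : Set (Coord d)) (f : Config d Γ → β) : Prop :=
  ∀ ω ω' : Config d Γ, (∀ c ∈ S, ω c = ω' c) → f ω = f ω'

/-- An event on pairs of configurations depending only on the coordinates of the first
configuration in `S1` and of the second one in `S2`. -/
def PairSupportedOn {d : ℕ} {Γ : Type*} (S1 S2 : Set (Coord d))
    (A : Set (Config d Γ × Config d Γ)) : Prop :=
  ∀ ω1 ω2 ω1' ω2' : Config d Γ, (∀ c ∈ S1, ω1 c = ω1' c) → (∀ c ∈ S2, ω2 c = ω2' c) →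
    ((ω1, ω2) ∈ A ↔ (ω1', ω2') ∈ A)

/-- The coordinates of the box `Q̄(x,r)`: vertices of the cube `Q(x,r)` together with
the edges having both endpoints in the cube. -/
def boxCoords {d : ℕ} (x : Vert d) (r : ℝ) : Set (Coord d) :=
  {c | ∀ v ∈ coordVerts c, v ∈ cubeVerts x r}

/-- The coordinates within `ℓ^∞`-distance `r` of `x` or `y` (the neighbourhoods
`𝒩 + x` and `𝒩 + y` together with the edge `{x,y}`). -/
def nbhdCoords {d : ℕ} (r : ℕ) (x y : Vert d) : Set (Coord d) :=
  {c | ∀ v ∈ coordVerts c, linfDist v x ≤ r ∨ linfDist v y ≤ r}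

/-- Two sets of coordinates are at mutual distance at least `r`. -/
def coordSetsFar {d : ℕ} (S1 S2 : Set (Coord d)) (r : ℝ) : Prop :=
  ∀ c1 ∈ S1, ∀ c2 ∈ S2, ∀ v1 ∈ coordVerts c1, ∀ v2 ∈ coordVerts c2,
    r ≤ (linfDist v1 v2 : ℝ)

/-! ## The conditions P1, P2, P3, P3', S1, S2 and Z -/

/-- Condition **P1** (invariance and directional ergodicity): each `P u` is invariant
under lattice shifts and every event invariant under a nonzero shift is trivial. -/
def CondP1 {d : ℕ} {Γ : Type*} [MeasurableSpace Γ]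
    (P : ℝ → Measure (Config d Γ)) (I : Set ℝ) : Prop :=
  ∀ u ∈ I, (∀ z : Vert d, MeasurePreserving (shiftConfig z) (P u) (P u)) ∧
    (∀ z : Vert d, z ≠ 0 → ∀ A : Set (Config d Γ), MeasurableSet A →
      shiftConfig z ⁻¹' A = A → P u A = 0 ∨ P u A = 1)

/-- Condition **P2** (stochastic monotonicity in the parameter `u`). -/
def CondP2 {d : ℕ} {Γ : Type*} [MeasurableSpace Γ] [Preorder Γ]
    (P : ℝ → Measure (Config d Γ)) (I : Set ℝ) : Prop :=
  ∀ f : Config d Γ → ℝ, Measurable f → Monotone f → (∀ ω, f ω ∈ Set.Icc (0:ℝ) 1) →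
    ∀ u ∈ I, ∀ u' ∈ I, u ≤ u' → ∫ ω, f ω ∂(P u) ≤ ∫ ω, f ω ∂(P u')

/-- Condition **P3** (decoupling inequality with sprinkling): after possibly
extending the underlying probability space (the extension is given by `Ω'`, `π`
and the family `Q`), for distant boxes and sprinkled levels there is an event `B`
of high probability on which increasing (resp. decreasing) events on the two boxes
can be compared with their probabilities under independent copies. -/
def CondP3 {d : ℕ} {Γ : Type*} [MeasurableSpace Γ] [Preorder Γ]
    (P : ℝ → Measure (Config d Γ)) (I : Set ℝ)
    (ξP εP aP CP χP RP LP : ℝ) : Prop :=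
  1 < ξP ∧ 0 < εP ∧ 0 < aP ∧ 0 < CP ∧ 0 < χP ∧ 0 < RP ∧ 0 < LP ∧
  ∃ (Ω' : Type) (mΩ' : MeasurableSpace Ω') (π : Ω' → Config d Γ)
    (Q : ℝ → @Measure Ω' mΩ') (fP : ℝ → ℝ),
    (@Measurable Ω' (Config d Γ) mΩ' _ π) ∧
    (∀ u ∈ I, @Measure.map Ω' (Config d Γ) mΩ' _ π (Q u) = P u) ∧
    (∀ L : ℝ, LP ≤ L → Real.exp (aP * Real.log L ^ εP) ≤ fP L) ∧
    ∀ (R L : ℝ) (x1 x2 : Vert d) (u uh : ℝ), u ∈ I → uh ∈ I → RP ≤ R → LP ≤ L →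
      (∀ v1 ∈ cubeVerts x1 (L ^ ξP), ∀ v2 ∈ cubeVerts x2 (L ^ ξP),
        R * L ≤ (linfDist v1 v2 : ℝ)) →
      uh + R ^ (-χP) ≤ u →
      ∃ B : Set Ω', @MeasurableSet Ω' mΩ' B ∧
        Q u Bᶜ ≤ ENNReal.ofReal (Real.exp (-(CP * fP L))) ∧
        (∀ A : Set (Config d Γ × Config d Γ), MeasurableSet A → IsUpperSet A →
            PairSupportedOn (boxCoords x1 (L ^ ξP)) (boxCoords x2 (L ^ ξP)) A →
            Q uh {ω' | ω' ∈ B ∧ (π ω', π ω') ∈ A} ≤ ((P u).prod (P u)) A) ∧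
        (∀ A : Set (Config d Γ × Config d Γ), MeasurableSet A → IsLowerSet A →
            PairSupportedOn (boxCoords x1 (L ^ ξP)) (boxCoords x2 (L ^ ξP)) A →
            Q u {ω' | ω' ∈ B ∧ (π ω', π ω') ∈ A} ≤ ((P uh).prod (P uh)) A)

/-- Condition **P3'** (decoupling inequality for sparse sets with super-exponential
error term). -/
def CondP3' {d : ℕ} {Γ : Type*} [MeasurableSpace Γ] [Preorder Γ]
    (P : ℝ → Measure (Config d Γ)) (I : Set ℝ)
    (ξP CP χP RP LP : ℝ) : Prop :=
  1 < ξP ∧ 0 < CP ∧ 0 < χP ∧ 0 < RP ∧ 0 < LP ∧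
  ∀ (R L : ℝ) (x1 x2 : Vert d) (u uh : ℝ), u ∈ I → uh ∈ I → RP ≤ R → LP ≤ L →
    uh + R ^ (-χP) ≤ u →
    ∀ S1 S2 : Set (Coord d), S1 ⊆ boxCoords x1 (L ^ ξP) → S2 ⊆ boxCoords x2 (L ^ ξP) →
      (S1.ncard : ℝ) ≤ L ^ ξP → (S2.ncard : ℝ) ≤ L ^ ξP →
      coordSetsFar S1 S2 (R * L) →
      (∀ f1 f2 : Config d Γ → ℝ, Measurable f1 → Measurable f2 →
        Monotone f1 → Monotone f2 →
        (∀ ω, f1 ω ∈ Set.Icc (0:ℝ) 1) → (∀ ω, f2 ω ∈ Set.Icc (0:ℝ) 1) →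
        SupportedOn S1 f1 → SupportedOn S2 f2 →
        ∫ ω, f1 ω * f2 ω ∂(P uh) ≤ (∫ ω, f1 ω ∂(P u)) * (∫ ω, f2 ω ∂(P u))
          + Real.exp (-(CP * L ^ ξP))) ∧
      (∀ f1 f2 : Config d Γ → ℝ, Measurable f1 → Measurable f2 →
        Antitone f1 → Antitone f2 →
        (∀ ω, f1 ω ∈ Set.Icc (0:ℝ) 1) → (∀ ω, f2 ω ∈ Set.Icc (0:ℝ) 1) →
        SupportedOn S1 f1 → SupportedOn S2 f2 →
        ∫ ω, f1 ω * f2 ω ∂(P u) ≤ (∫ ω, f1 ω ∂(P uh)) * (∫ ω, f2 ω ∂(P uh))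
          + Real.exp (-(CP * L ^ ξP)))

/-- Condition **(Z)**: `liminf_{L→∞} sup_x P^u(Q(x,L) ↔ Q(x,2L)^c in {e : t_e = 0}) = 0`
for every `u ∈ I`. -/
def CondZ {d : ℕ} {Γ : Type*} [MeasurableSpace Γ]
    (P : ℝ → Measure (Config d Γ)) (I : Set ℝ)
    (w : Config d Γ → Vert d → Vert d → ℝ≥0∞) : Prop :=
  ∀ u ∈ I,
    Filter.liminf (fun L : ℕ =>
      ⨆ x : Vert d, P u {ω | ∃ v1 ∈ cubeVerts x (L : ℝ), ∃ v2,
        v2 ∉ cubeVerts x ((2 * L : ℕ) : ℝ) ∧ ConnectedIn (zeroSet (w ω)) v1 v2})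
      Filter.atTop = 0

/-- The function `g_P^{(δ)}` of the main theorem: equal to `L` if condition P3' holds
and otherwise given by the P3-formula. -/
noncomputable def gP3formula (δ εP aP χP L : ℝ) : ℝ :=
  min L (Real.log L ^ (-(δ * (1 + aP + aP / χP))) * Real.exp (aP * Real.log L ^ εP))

noncomputable def gdelta (p3' : Prop) (δ εP aP χP L : ℝ) : ℝ :=
  if p3' then L else gP3formula δ εP aP χP L

/-! ## The renormalization scheme -/

/-- `ρ_k = ρ` for `k < K` and `ρ_k = 1` for `k ≥ K`. -/
def rhok (ρ K k : ℕ) : ℕ := if k < K then ρ else 1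

/-- The sequence of scales `L_{k+1} = 2 L_k (1 + ρ_k/(k+6)^δ)`. -/
noncomputable def Lseq (δ : ℝ) (ρ K : ℕ) (L0 : ℝ) : ℕ → ℝ
  | 0 => L0
  | k + 1 => 2 * Lseq δ ρ K L0 k * (1 + (rhok ρ K k : ℝ) / ((k : ℝ) + 6) ^ δ)

/-- The box `C_x^k = x + [0, L_k)^d ∩ ℤ^d`. -/
def CkSet {d : ℕ} (δ : ℝ) (ρ K : ℕ) (L0 : ℝ) (k : ℕ) (x : Vert d) : Set (Vert d) :=
  {y | ∀ i, (0:ℝ) ≤ ((y i - x i : ℤ) : ℝ) ∧ ((y i - x i : ℤ) : ℝ) < Lseq δ ρ K L0 k}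

/-- The box `D_x^k = x + [-L_k, 2 L_k)^d ∩ ℤ^d`. -/
def DkSet {d : ℕ} (δ : ℝ) (ρ K : ℕ) (L0 : ℝ) (k : ℕ) (x : Vert d) : Set (Vert d) :=
  {y | ∀ i, -(Lseq δ ρ K L0 k) ≤ ((y i - x i : ℤ) : ℝ) ∧
    ((y i - x i : ℤ) : ℝ) < 2 * Lseq δ ρ K L0 k}

/-- `d_k^ω(x)`: the FPP distance between `C_x^k` and the complement of `D_x^k`. -/
noncomputable def dkDist {d : ℕ} (δ : ℝ) (ρ K : ℕ) (L0 : ℝ) (k : ℕ) (x : Vert d)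
    (w : Vert d → Vert d → ℝ≥0∞) : ℝ≥0∞ :=
  ⨅ p : {p : List (Vert d) // ∃ a b, a ∈ CkSet δ ρ K L0 k x ∧ b ∉ DkSet δ ρ K L0 k x ∧
      IsPathFrom a b p}, pathWeight w p.1

/-- `ε_k = Σ_{p ≥ k} ε/(p+6)^δ`. -/
noncomputable def epsk (δ ε : ℝ) (k : ℕ) : ℝ :=
  ∑' j : ℕ, ε / (((k + j : ℕ) : ℝ) + 6) ^ δ

/-- `a_k = 2^k ∏_{i=0}^{k-1} (1 - 1/(i+6)^δ)`. -/
noncomputable def aseq (δ : ℝ) (k : ℕ) : ℝ :=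
  2 ^ k * ∏ i ∈ Finset.range k, (1 - 1 / (((i : ℕ) : ℝ) + 6) ^ δ)

/-- A path visits `A` and visits the complement of `B` ("the path connects `A` to
`B^c`"). -/
def Crosses {d : ℕ} (p : List (Vert d)) (A B : Set (Vert d)) : Prop :=
  (∃ v ∈ p, v ∈ A) ∧ (∃ v ∈ p, v ∉ B)

/-- Two sets of vertices at mutual `ℓ^∞`-distance at least `r`. -/
def SetDistGE {d : ℕ} (A B : Set (Vert d)) (r : ℝ) : Prop :=
  ∀ a ∈ A, ∀ b ∈ B, r ≤ (linfDist a b : ℝ)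

/-- A proper embedding of the binary tree of depth `k` with base `x`, where tree
vertices of depth `n` are encoded as lists of booleans of length `n` and children
are obtained by appending a bit. -/
def ProperEmbedding {d : ℕ} (δ : ℝ) (ρ K : ℕ) (L0 : ℝ)
    (xseq yseq : ℕ → ℕ → Vert d) (k : ℕ) (x : Vert d) (τ : List Bool → Vert d) : Prop :=
  τ [] = x ∧
  (∀ n, n < k → ∀ σ : List Bool, σ.length = n →
    ∃ i < (2 + rhok ρ K (k - n - 1)) ^ d, ∃ j < 2 * d * (6 + rhok ρ K (k - n - 1)) ^ (d - 1),
      τ (σ ++ [true]) = τ σ + xseq (k - n - 1) i ∧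
      τ (σ ++ [false]) = τ σ + yseq (k - n - 1) j) ∧
  (∀ n, n < k → ∀ σ σ' : List Bool, σ.length = n → σ'.length = k - n →
    (DkSet δ ρ K L0 (k - n) (τ σ) ∩ DkSet δ ρ K L0 0 (τ (σ ++ σ'))).Nonempty)

/-- The countable product measure `ν = μ^{⊗ℕ}` characterised on cylinders. -/
def IsIIDProduct {Ω : Type*} [MeasurableSpace Ω] (μ : Measure Ω)
    (ν : Measure (ℕ → Ω)) : Prop :=
  ∀ (s : Finset ℕ) (f : ℕ → Set Ω), (∀ i ∈ s, MeasurableSet (f i)) →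
    ν {ωt | ∀ i ∈ s, ωt i ∈ f i} = ∏ i ∈ s, μ (f i)

/-- The Lorentz `L(d,1)`-norm of a nonnegative random variable. -/
noncomputable def lorentzNorm {Ω : Type*} [MeasurableSpace Ω] (d : ℕ) (P : Measure Ω)
    (X : Ω → ℝ≥0∞) : ℝ≥0∞ :=
  ∫⁻ s in Set.Ioi (0:ℝ), (P {ω | ENNReal.ofReal s < X ω}) ^ ((1:ℝ) / d)

/-! ## The discrete Gaussian free field -/

/-- The neighbours of a vertex of `ℤ^d`. -/
def nbrs {d : ℕ} (x : Vert d) : Finset (Vert d) :=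
  (Finset.univ : Finset (Fin d × Bool)).image
    (fun p => Function.update x p.1 (x p.1 + if p.2 then 1 else -1))

/-- The number of nearest-neighbour walks of length `n` from `x` to `y`. -/
def nStepCount (d : ℕ) : ℕ → Vert d → Vert d → ℕ
  | 0, x, y => if x = y then 1 else 0
  | n + 1, x, y => ∑ z ∈ nbrs x, nStepCount d n z y

/-- The Green function of the simple random walk on `ℤ^d` (with unit weights). -/
noncomputable def greenSRW (d : ℕ) (x y : Vert d) : ℝ≥0∞ :=
  ∑' n : ℕ, (nStepCount d n x y : ℝ≥0∞) / ((2 * d : ℕ) : ℝ≥0∞) ^ n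

/-- `φ` is a centred Gaussian field with covariance `cov` under `P`, characterised by
the moment generating functions of its finite linear combinations. -/
def IsCenteredGaussianField {d : ℕ} {Ω : Type*} [MeasurableSpace Ω] (P : Measure Ω)
    (φ : Ω → Vert d → ℝ) (cov : Vert d → Vert d → ℝ) : Prop :=
  (∀ x, Measurable fun ω => φ ω x) ∧
  ∀ (s : Finset (Vert d)) (c : Vert d → ℝ) (t : ℝ),
    ∫ ω, Real.exp (t * ∑ x ∈ s, c x * φ ω x) ∂P =
      Real.exp (t ^ 2 * (∑ x ∈ s, ∑ y ∈ s, c x * c y * cov x y) / 2)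

/-- The set `S` of vertices percolates (contains an infinite cluster). -/
def PercolatesIn {d : ℕ} (S : Set (Vert d)) : Prop :=
  ∃ x, {y | VConnectedIn S x y}.Infinite

/-- The critical level `h_*` for level-set percolation of the field `φ`. -/
noncomputable def hstar {d : ℕ} {Ω : Type*} [MeasurableSpace Ω] (P : Measure Ω)
    (φ : Ω → Vert d → ℝ) : ℝ :=
  sSup {h : ℝ | P {ω | PercolatesIn {x | h ≤ φ ω x}} ≠ 0}

/-- `h_f = inf {t : f t = 0}` as an extended real number (`⊤` if `f` has no zero). -/
noncomputable def hfEReal (f : ℝ → ℝ) : EReal :=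
  sInf {x : EReal | ∃ s : ℝ, f s = 0 ∧ x = (s : EReal)}

/-! ## Random conductance models -/

/-- An edge is open for conductances `a` if it is a lattice edge with positive
conductance. -/
def openAdj {d : ℕ} (a : Vert d → Vert d → ℝ) (x y : Vert d) : Prop :=
  adj x y ∧ 0 < a x y

/-- A path using only open edges. -/
def IsOpenPath {d : ℕ} (a : Vert d → Vert d → ℝ) (x y : Vert d) (p : List (Vert d)) :
    Prop :=
  p.head? = some x ∧ p.getLast? = some y ∧ p.Chain' (openAdj a)

/-- Connectivity by open paths. -/
def openConn {d : ℕ} (a : Vert d → Vert d → ℝ) (x y : Vert d) : Prop :=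
  ∃ p, IsOpenPath a x y p

/-- The union of the infinite open clusters (the infinite cluster `C_∞` when it is
unique). -/
def Cinf {d : ℕ} (a : Vert d → Vert d → ℝ) : Set (Vert d) :=
  {x | {y | openConn a x y}.Infinite}

/-- The chemical (graph) distance on the open cluster. -/
noncomputable def chemDist {d : ℕ} (a : Vert d → Vert d → ℝ) (x y : Vert d) : ℝ≥0∞ :=
  ⨅ p : {p : List (Vert d) // IsOpenPath a x y p}, ((p.1.length - 1 : ℕ) : ℝ≥0∞)

/-- The closed ball of radius `r` for the chemical distance. -/
def ballCh {d : ℕ} (a : Vert d → Vert d → ℝ) (x : Vert d) (r : ℝ) : Set (Vert d) :=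
  {y | chemDist a x y ≤ ENNReal.ofReal r}

/-- `μ^ω(x) = Σ_{y∼x} a(x,y)`. -/
noncomputable def muA {d : ℕ} (a : Vert d → Vert d → ℝ) (x : Vert d) : ℝ :=
  ∑ y ∈ nbrs x, a x y

/-- `ν^ω(x) = Σ_{y∼x, a(x,y)>0} a(x,y)⁻¹`. -/
noncomputable def nuA {d : ℕ} (a : Vert d → Vert d → ℝ) (x : Vert d) : ℝ :=
  ∑ y ∈ nbrs x, if 0 < a x y then (a x y)⁻¹ else 0

/-- The space-averaged `ℓ^p`-norm `‖f‖_{p,A}` (maximum norm for `p = ∞`). -/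
noncomputable def avgNormR {d : ℕ} (p : ℝ≥0∞) (A : Set (Vert d)) (f : Vert d → ℝ) : ℝ :=
  if p = ∞ then sSup ((fun x => |f x|) '' A)
  else ((∑' x : A, |f (x : Vert d)| ^ p.toReal) / (A.ncard : ℝ)) ^ (1 / p.toReal)

/-- The sum `Σ_{{y,z} open edge} |f(y) - f(z)|` (each unordered edge counted once). -/
noncomputable def edgeGradSum {d : ℕ} (a : Vert d → Vert d → ℝ) (f : Vert d → ℝ) : ℝ :=
  (1 / 2) * ∑' e : Vert d × Vert d, if openAdj a e.1 e.2 then |f e.2 - f e.1| else 0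

/-- The graph assumption: volume regularity of order `d` and a Sobolev inequality
with exponent `d' ≥ d` on large balls of the infinite cluster. -/
def GraphAssumption {d : ℕ} (d' : ℝ) (a : Vert d → Vert d → ℝ)
    (N4 N5 : Vert d → ℕ) (Creg CS1 : ℝ) : Prop :=
  1 ≤ Creg ∧ 1 ≤ CS1 ∧ (d : ℝ) ≤ d' ∧
  (∀ x ∈ Cinf a, ∀ n : ℕ, N4 x ≤ n →
    Creg⁻¹ * (n : ℝ) ^ d ≤ ((ballCh a x n).ncard : ℝ) ∧
      ((ballCh a x n).ncard : ℝ) ≤ Creg * (n : ℝ) ^ d) ∧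
  (∀ x ∈ Cinf a, ∀ n : ℕ, N5 x ≤ n → ∀ f : Vert d → ℝ,
    (∀ y, f y ≠ 0 → y ∈ ballCh a x n) →
    avgNormR (ENNReal.ofReal (d' / (d' - 1))) (ballCh a x n) f ≤
      CS1 * n / ((ballCh a x n).ncard : ℝ) * edgeGradSum a f)

/-- The generator `(ℒ f)(x) = Σ_{y∼x} a(x,y)(f(y)-f(x)) - h κ(x) f(x)`. -/
noncomputable def genL {d : ℕ} (a : Vert d → Vert d → ℝ) (κ : Vert d → ℝ) (h : ℝ)
    (f : Vert d → ℝ) (x : Vert d) : ℝ :=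
  (∑ y ∈ nbrs x, a x y * (f y - f x)) - h * κ x * f x

/-- The carré du champ `Γ(f,g)(x) = Σ_{y∼x} a(x,y)(f(y)-f(x))(g(y)-g(x))`. -/
noncomputable def carre {d : ℕ} (a : Vert d → Vert d → ℝ) (f g : Vert d → ℝ)
    (x : Vert d) : ℝ :=
  ∑ y ∈ nbrs x, a x y * (f y - f x) * (g y - g x)

/-- The weighted carré du champ
`Γ_η(f,g)(x) = Σ_{y∼x} av(η²)({x,y}) a(x,y)(f(y)-f(x))(g(y)-g(x))`. -/
noncomputable def carreEta {d : ℕ} (a : Vert d → Vert d → ℝ) (η f g : Vert d → ℝ)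
    (x : Vert d) : ℝ :=
  ∑ y ∈ nbrs x, ((η x ^ 2 + η y ^ 2) / 2) * (a x y * (f y - f x) * (g y - g x))

/-- The Dirichlet form `E(f) = ⟨∇f, a ∇f⟩ + h ⟨f, κ f⟩`. -/
noncomputable def dirichletE {d : ℕ} (a : Vert d → Vert d → ℝ) (κ : Vert d → ℝ)
    (h : ℝ) (f : Vert d → ℝ) : ℝ :=
  (1 / 2) * (∑' e : Vert d × Vert d,
      if adj e.1 e.2 then a e.1 e.2 * (f e.2 - f e.1) ^ 2 else 0) +
    h * ∑' x, κ x * f x ^ 2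

/-- `g` is the Green function on `C` of the walk with conductances `a` and killing
measure `h·κ`: the minimal nonnegative fundamental solution of `ℒ g(·,y) = -𝟙_y`. -/
def IsGreenFn {d : ℕ} (a : Vert d → Vert d → ℝ) (κ : Vert d → ℝ) (h : ℝ)
    (C : Set (Vert d)) (g : Vert d → Vert d → ℝ) : Prop :=
  (∀ x y, 0 ≤ g x y) ∧
  (∀ y ∈ C, ∀ x ∈ C, genL a κ h (fun z => g z y) x = -(if x = y then (1:ℝ) else 0)) ∧
  (∀ g' : Vert d → Vert d → ℝ, (∀ x y, 0 ≤ g' x y) →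
    (∀ y ∈ C, ∀ x ∈ C, genL a κ h (fun z => g' z y) x ≤ -(if x = y then (1:ℝ) else 0)) →
    ∀ x ∈ C, ∀ y ∈ C, g x y ≤ g' x y)

/-- `q t x y = P_x(X_t = y)` is the (minimal) transition function of the Markov chain
with jump rates `a(x,y)/θ(x)`, characterised via the backward Kolmogorov equations. -/
def IsHeatSemigroup {d : ℕ} (a : Vert d → Vert d → ℝ) (θ : Vert d → ℝ)
    (q : ℝ → Vert d → Vert d → ℝ) : Prop :=
  (∀ x y, q 0 x y = if x = y then (1:ℝ) else 0) ∧
  (∀ t x y, 0 ≤ q t x y) ∧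
  (∀ t x, ∑' y, q t x y ≤ 1) ∧
  (∀ x y, ∀ t : ℝ, 0 ≤ t →
    HasDerivAt (fun s => q s x y) (∑ z ∈ nbrs x, a x z / θ x * (q t z y - q t x y)) t) ∧
  (∀ q' : ℝ → Vert d → Vert d → ℝ,
    (∀ x y, q' 0 x y = if x = y then (1:ℝ) else 0) →
    (∀ t x y, 0 ≤ q' t x y) →
    (∀ x y, ∀ t : ℝ, 0 ≤ t →
      HasDerivAt (fun s => q' s x y)
        (∑ z ∈ nbrs x, a x z / θ x * (q' t z y - q' t x y)) t) →
    ∀ t : ℝ, 0 ≤ t → ∀ x y, q t x y ≤ q' t x y)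

/-- The FPP edge weight `(1 ∧ (κ(x) ∧ κ(y))/a(x,y))^{1/2}` (equal to `∞` on closed
edges); used both for the metric `d_κ` and, with `θ` in place of `κ`, for `d_θ`. -/
noncomputable def kapWeightE {d : ℕ} (a : Vert d → Vert d → ℝ) (κ : Vert d → ℝ)
    (x y : Vert d) : ℝ≥0∞ :=
  if 0 < a x y then ENNReal.ofReal (Real.sqrt (min 1 (min (κ x) (κ y) / a x y))) else ∞

/-- The FPP-type metric `d_κ` on the open cluster. -/
noncomputable def dkap {d : ℕ} (a : Vert d → Vert d → ℝ) (κ : Vert d → ℝ)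
    (x y : Vert d) : ℝ≥0∞ :=
  ⨅ p : {p : List (Vert d) // IsOpenPath a x y p},
    ((edgesOf p.1).map fun e => kapWeightE a κ e.1 e.2).sum

/-- `F_γ(r) = (1+r)^γ (1+1/r)^{1/2}` in `ℝ≥0∞` (so `F_γ(0) = ∞`). -/
noncomputable def FgamE (γ r : ℝ) : ℝ≥0∞ :=
  (1 + ENNReal.ofReal r) ^ γ * (1 + (ENNReal.ofReal r)⁻¹) ^ ((1:ℝ) / 2)

/-- The open cluster of `x` has `ℓ^1`-diameter at least `r`. -/
def clusterDiamGE {d : ℕ} (a : Vert d → Vert d → ℝ) (x : Vert d) (r : ℝ) : Prop :=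
  ∃ y z, openConn a x y ∧ openConn a x z ∧ r ≤ (l1Dist y z : ℝ)

/-- Condition **S1** (local uniqueness of large clusters). -/
def CondS1 {d : ℕ} {Γ : Type*} [MeasurableSpace Γ]
    (P : ℝ → Measure (Config d Γ)) (I : Set ℝ)
    (aC : Config d Γ → Vert d → Vert d → ℝ) : Prop :=
  ∃ fS : ℝ → ℕ → ℝ, ∀ u ∈ I, ∃ ΔS RS : ℝ, 0 < ΔS ∧
    (∀ R : ℕ, RS ≤ R → Real.log (R : ℝ) ^ (1 + ΔS) ≤ fS u R) ∧
    ∀ R : ℕ, 1 ≤ R →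
      (ENNReal.ofReal (1 - Real.exp (-(fS u R))) ≤
        P u {ω | ∃ x ∈ cubeVerts (0 : Vert d) (R : ℝ), clusterDiamGE (aC ω) x (R : ℝ)}) ∧
      (ENNReal.ofReal (1 - Real.exp (-(fS u R))) ≤
        P u {ω | ∀ x ∈ cubeVerts (0 : Vert d) (R : ℝ), ∀ y ∈ cubeVerts (0 : Vert d) (R : ℝ),
          clusterDiamGE (aC ω) x ((R : ℝ) / 10) → clusterDiamGE (aC ω) y ((R : ℝ) / 10) →
          ∃ p, IsOpenPath (aC ω) x y p ∧ ∀ v ∈ p, v ∈ cubeVerts (0 : Vert d) ((2 * R : ℕ) : ℝ)})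

/-- Condition **S2**: `u ↦ P^u(0 ∈ C_∞)` is positive and continuous on `I`. -/
def CondS2 {d : ℕ} {Γ : Type*} [MeasurableSpace Γ]
    (P : ℝ → Measure (Config d Γ)) (I : Set ℝ)
    (aC : Config d Γ → Vert d → Vert d → ℝ) : Prop :=
  (∀ u ∈ I, 0 < P u {ω | (0 : Vert d) ∈ Cinf (aC ω)}) ∧
  ContinuousOn (fun u => (P u {ω | (0 : Vert d) ∈ Cinf (aC ω)}).toReal) I

/-- Weighted `p`-th moment `E[X^p w]` (essential supremum of `X` for `p = ∞`). -/
noncomputable def wMoment {Ω : Type*} [MeasurableSpace Ω] (μm : Measure Ω) (p : ℝ≥0∞)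
    (X w : Ω → ℝ≥0∞) : ℝ≥0∞ :=
  if p = ∞ then essSup X μm else ∫⁻ ω, X ω ^ p.toReal * w ω ∂μm

/-- `p_* = p/(p-1)` (with `∞_* = 1`). -/
noncomputable def pstar (p : ℝ≥0∞) : ℝ≥0∞ :=
  if p = ∞ then 1 else ENNReal.ofReal (p.toReal / (p.toReal - 1))

/-- `‖∇η‖_{ℓ^∞(E)}`: the supremum of `|η(y)-η(x)|` over open edges. -/
noncomputable def gradSup {d : ℕ} (a : Vert d → Vert d → ℝ) (η : Vert d → ℝ) : ℝ :=
  sSup {r : ℝ | ∃ x y, openAdj a x y ∧ r = |η y - η x|}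

/-- `exp(-ζ x)` for `x ∈ ℝ≥0∞` (equal to `0` at `x = ∞`). -/
noncomputable def expNegE (ζ : ℝ) (x : ℝ≥0∞) : ℝ≥0∞ :=
  if x = ∞ then 0 else ENNReal.ofReal (Real.exp (-(ζ * x.toReal)))

/-- The `m^ω(n)` factor of the maximal inequality. -/
noncomputable def mBound {d : ℕ} (a : Vert d → Vert d → ℝ) (p q : ℝ≥0∞)
    (phi : Vert d → ℝ) (x0 : Vert d) (n : ℕ) : ℝ :=
  avgNormR p (ballCh a x0 (n : ℝ)) (fun x => max 1 (muA a x)) *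
    avgNormR q (ballCh a x0 (n : ℝ)) (fun x => max 1 (nuA a x)) *
    (1 + avgNormR p (ballCh a x0 (n : ℝ)) (carre a phi fun z => (phi z)⁻¹) * (n : ℝ) ^ 2)

/-- The Caccioppoli estimate with constant `c35` (for the data `a`, `κ`, `h`). -/
def CaccEst {d : ℕ} (a : Vert d → Vert d → ℝ) (κ : Vert d → ℝ) (h : ℝ) (c35 : ℝ) :
    Prop :=
  ∀ B : Set (Vert d), B.Finite → B ⊆ Cinf a →
    (∀ x ∈ B, ∀ y ∈ B, ∃ p, IsOpenPath a x y p ∧ ∀ v ∈ p, v ∈ B) →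
  ∀ η : Vert d → ℝ, (∀ x, η x ∈ Set.Icc (0:ℝ) 1) → (∀ x, η x ≠ 0 → x ∈ B) →
    (∀ x ∈ B, (∃ y, y ∉ B ∧ openAdj a x y) → η x = 0) →
  ∀ u : Vert d → ℝ, (∀ x, 0 ≤ u x) → (∀ x ∈ B, 0 ≤ genL a κ h u x) →
  ∀ phi : Vert d → ℝ, (∀ x, 0 < phi x) →
  ∀ α : ℝ, 1 ≤ α →
    dirichletE a κ h (fun x => η x * (phi x * u x) ^ α) ≤
      c35 * α ^ 2 * ∑' x, (phi x * u x) ^ (2 * α) *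
        (carre a η η x - carreEta a η phi (fun z => (phi z)⁻¹) x)


lemma mem_nbrs {d : ℕ} (x y : Vert d) : y ∈ nbrs x ↔ adj x y := by
  unfold nbrs adj
  simp only [Finset.mem_image, Finset.mem_univ, true_and, Prod.exists]
  constructor
  · rintro ⟨i, b, rfl⟩
    rw [Finset.sum_eq_single i]
    · cases b <;> simp
    · intro j _ hj
      simp [Function.update_of_ne hj]
    · simp
  · intro hs
    have hex : ∃ i, (x i - y i).natAbs ≠ 0 := by
      by_contra hc
      push Not at hc
      simp [hc] at hs
    obtain ⟨i, hi⟩ := hex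
    rw [← Finset.add_sum_erase _ _ (Finset.mem_univ i)] at hs
    have h0 : ∑ j ∈ Finset.univ.erase i, (x j - y j).natAbs = 0 := by omega
    have h1 : (x i - y i).natAbs = 1 := by omega
    rw [Finset.sum_eq_zero_iff] at h0
    have hj : ∀ j, j ≠ i → y j = x j := by
      intro j hji
      have := h0 j (Finset.mem_erase.2 ⟨hji, Finset.mem_univ j⟩)
      omega
    have hcase : y i = x i + 1 ∨ y i = x i + -1 := by omega
    rcases hcase with hc | hc
    · refine ⟨i, true, ?_⟩
      funext j
      by_cases hji : j = i
      · subst hji; simp [hc]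
      · simp [Function.update_of_ne hji, hj j hji]
    · refine ⟨i, false, ?_⟩
      funext j
      by_cases hji : j = i
      · subst hji; simp [hc]
      · simp [Function.update_of_ne hji, hj j hji]

lemma adj_symm {d : ℕ} (x y : Vert d) : adj x y ↔ adj y x := by
  unfold adj
  have : ∀ i, (x i - y i).natAbs = (y i - x i).natAbs := by intro i; omega
  simp [this]

lemma nbrs_sum {d : ℕ} (T : Finset (Vert d)) (x : Vert d) (f : Vert d → ℝ)
    (hf : ∀ y, adj x y → y ∉ T → f y = 0) :
    ∑ y ∈ nbrs x, f y = ∑ y ∈ T, if adj x y then f y else 0 := by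
  rw [← Finset.sum_filter]
  symm
  apply Finset.sum_subset
  · intro y hy
    exact (mem_nbrs x y).2 (Finset.mem_filter.1 hy).2
  · intro y hy hy'
    have ha := (mem_nbrs x y).1 hy
    exact hf y ha (fun hT => hy' (Finset.mem_filter.2 ⟨hT, ha⟩))

lemma key_far (α s t r z b Z : ℝ) (hα : 1 ≤ α) (hs : 0 ≤ s) (ht : 0 ≤ t) (hr : 0 < r)
    (hZ0 : 0 ≤ Z) (hZb : Z ≤ b) (hbz : b ≤ z) (hz1 : z ≤ 1)
    (hfar : 1 / 2 < |r - 1|) :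
    (t - s * b) ^ 2 - 4 * α * ((t ^ 2 - s ^ 2 * Z / r) * (1 - r * z)) ≤
      500 * α ^ 2 * ((t - s) ^ 2 + (s ^ 2 + t ^ 2) / 2 * ((r - 1) ^ 2 / r)) := by
  set ρ := (r - 1) ^ 2 / r with hρ
  have e1 : r + 1 / r = ρ + 2 := by rw [hρ]; field_simp; ring
  have hρ6 : 1 / 6 ≤ ρ := by
    rw [hρ, le_div_iff₀ hr]
    rcases lt_abs.1 hfar with h | h
    · nlinarith
    · nlinarith
  have hri : 0 < 1 / r := by positivity
  set m := (s ^ 2 + t ^ 2) / 2 with hm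
  have hm0 : 0 ≤ m := by positivity
  have hb0 : 0 ≤ b := hZ0.trans hZb
  have hb1 : b ≤ 1 := hbz.trans hz1
  have h1 : (t - s * b) ^ 2 ≤ 2 * m := by
    have : s ^ 2 * b ^ 2 ≤ s ^ 2 := by
      have : b ^ 2 ≤ 1 := by nlinarith
      nlinarith [sq_nonneg s]
    have : 0 ≤ t * s * b := by positivity
    rw [hm]; nlinarith
  have hF : -((t ^ 2 - s ^ 2 * Z / r) * (1 - r * z)) ≤ 2 * m * (ρ + 2) := by
    have ex : (t ^ 2 - s ^ 2 * Z / r) * (1 - r * z)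
        = t ^ 2 - t ^ 2 * (r * z) + s ^ 2 * z * Z - s ^ 2 * Z * (1 / r) := by
      field_simp; ring
    have a1 : t ^ 2 * (r * z) ≤ t ^ 2 * r := by
      apply mul_le_mul_of_nonneg_left _ (sq_nonneg t); nlinarith
    have a2 : s ^ 2 * Z * (1 / r) ≤ s ^ 2 * (1 / r) := by
      apply mul_le_mul_of_nonneg_right _ hri.le
      nlinarith [sq_nonneg s]
    have a3 : 0 ≤ s ^ 2 * z * Z := by
      have : 0 ≤ z := hb0.trans hbz
      positivity
    have a4 : t ^ 2 * r + s ^ 2 * (1 / r) ≤ 2 * m * (r + 1 / r) := by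
      have : 0 ≤ t ^ 2 * (1 / r) := by positivity
      have : 0 ≤ s ^ 2 * r := by positivity
      rw [hm]; nlinarith
    rw [ex, ← e1]; nlinarith [sq_nonneg t]
  have h2 : 2 * m * (ρ + 2) ≤ 26 * (m * ρ) := by nlinarith
  have h3 : 2 * m ≤ 12 * (m * ρ) := by nlinarith
  have hmρ : 0 ≤ m * ρ := by nlinarith
  have h4 : α ≤ α ^ 2 := by nlinarith
  have h5 : 4 * α * -((t ^ 2 - s ^ 2 * Z / r) * (1 - r * z)) ≤ 4 * α * (26 * (m * ρ)) :=
    mul_le_mul_of_nonneg_left (hF.trans h2) (by linarith)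
  have h6 : α * (m * ρ) ≤ α ^ 2 * (m * ρ) := mul_le_mul_of_nonneg_right h4 hmρ
  have h7 : (m * ρ) ≤ α ^ 2 * (m * ρ) := by nlinarith
  have h8 : 0 ≤ α ^ 2 * (t - s) ^ 2 := by positivity
  nlinarith

set_option maxHeartbeats 2000000 in
lemma key_near (α s t r z b Z : ℝ) (hα : 1 ≤ α) (hs : 0 ≤ s) (ht : 0 ≤ t) (hr : 0 < r)
    (hZ0 : 0 ≤ Z) (hZb : Z ≤ b) (hbz : b ≤ z) (hz1 : z ≤ 1) (hbZ : b ^ 2 ≤ Z)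
    (hber : 1 - b ≤ α * (1 - z))
    (hnear : |r - 1| ≤ 1 / 2) :
    (t - s * b) ^ 2 - 4 * α * ((t ^ 2 - s ^ 2 * Z / r) * (1 - r * z)) ≤
      500 * α ^ 2 * ((t - s) ^ 2 + (s ^ 2 + t ^ 2) / 2 * ((r - 1) ^ 2 / r)) := by
  set ρ := (r - 1) ^ 2 / r with hρ
  obtain ⟨ε, hε⟩ : ∃ ε, ε = |r - 1| := ⟨_, rfl⟩
  obtain ⟨D, hD⟩ : ∃ D, D = |t - s| := ⟨_, rfl⟩
  obtain ⟨g, hg⟩ : ∃ g, g = 1 - b := ⟨_, rfl⟩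
  have hε0 : 0 ≤ ε := hε ▸ abs_nonneg _
  have hD0 : 0 ≤ D := hD ▸ abs_nonneg _
  have hb0 : 0 ≤ b := hZ0.trans hZb
  have hb1 : b ≤ 1 := hbz.trans hz1
  have hz0 : 0 ≤ z := hb0.trans hbz
  have hZ1 : Z ≤ 1 := hZb.trans hb1
  have hg0 : 0 ≤ g := by linarith
  have hg1 : g ≤ 1 := by linarith
  have hε2 : ε ^ 2 = (r - 1) ^ 2 := by rw [hε, sq_abs]
  have hD2 : D ^ 2 = (t - s) ^ 2 := by rw [hD, sq_abs]
  rw [← hε] at hnear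
  have hrb := abs_le.1 (hε ▸ hnear : |r - 1| ≤ 1 / 2)
  have hρ0 : 0 ≤ ρ := by rw [hρ]; positivity
  have hερ : ε ^ 2 ≤ 3 / 2 * ρ := by
    have : ε ^ 2 = ρ * r := by rw [hε2, hρ]; field_simp
    rw [this]; nlinarith
  have hinv : |1 - 1 / r| ≤ 2 * ε := by
    have : 1 - 1 / r = (r - 1) / r := by field_simp
    rw [this, abs_div, abs_of_pos hr, ← hε, div_le_iff₀ hr]
    nlinarith
  have hts : |t ^ 2 - s ^ 2| ≤ 2 * t * D + D ^ 2 := by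
    have : t ^ 2 - s ^ 2 = (t - s) * (t + s) := by ring
    rw [this, abs_mul, ← hD, abs_of_nonneg (by linarith : 0 ≤ t + s)]
    have : s ≤ t + D := by
      have := neg_abs_le (t - s); rw [← hD] at this; linarith
    nlinarith
  have hs2 : s ^ 2 ≤ 2 * t ^ 2 + 2 * D ^ 2 := by
    rw [hD2]; nlinarith [sq_nonneg (2 * t - s)]
  have h1mZ : 1 - Z ≤ 2 * g := by nlinarith
  have h1mz : 1 - z ≤ g := by linarith
  -- decomposition
  have ex : (t ^ 2 - s ^ 2 * Z / r) * (1 - r * z)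
      = t ^ 2 * ((1 - Z) * (1 - z)) - (r - 1) * (t ^ 2 * (1 - Z) * z)
        + (t ^ 2 - s ^ 2) * (Z * (1 - z)) - ((t ^ 2 - s ^ 2) * (r - 1)) * (Z * z)
        + (1 - 1 / r) * (s ^ 2 * Z * (1 - z)) - s ^ 2 * Z * z * ρ := by
    rw [hρ]; field_simp; ring
  have b1 : g ^ 2 ≤ α * ((1 - Z) * (1 - z)) := by
    have : g * g ≤ (1 - Z) * (α * (1 - z)) :=
      mul_le_mul (by linarith) (by linarith) hg0 (by linarith)
    linarith
  have b2 : (r - 1) * (t ^ 2 * (1 - Z) * z) ≤ 2 * (t ^ 2 * g * ε) := by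
    have q0 : 0 ≤ t ^ 2 * (1 - Z) * z := by
      have : 0 ≤ 1 - Z := by linarith
      positivity
    have q1 : t ^ 2 * (1 - Z) * z ≤ t ^ 2 * (2 * g) := by
      rw [mul_assoc]
      apply mul_le_mul_of_nonneg_left _ (sq_nonneg t)
      exact (mul_le_of_le_one_right (by linarith) hz1).trans h1mZ
    calc (r - 1) * (t ^ 2 * (1 - Z) * z) ≤ ε * (t ^ 2 * (1 - Z) * z) :=
          mul_le_mul_of_nonneg_right (hε ▸ le_abs_self _) q0
      _ ≤ ε * (t ^ 2 * (2 * g)) := mul_le_mul_of_nonneg_left q1 hε0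
      _ = _ := by ring
  have b3 : -((t ^ 2 - s ^ 2) * (Z * (1 - z))) ≤ (2 * t * D + D ^ 2) * g := by
    have q0 : 0 ≤ Z * (1 - z) := mul_nonneg hZ0 (by linarith)
    have q1 : Z * (1 - z) ≤ g := (mul_le_of_le_one_left (by linarith) hZ1).trans h1mz
    calc -((t ^ 2 - s ^ 2) * (Z * (1 - z))) = -(t ^ 2 - s ^ 2) * (Z * (1 - z)) := by ring
      _ ≤ (2 * t * D + D ^ 2) * (Z * (1 - z)) :=
          mul_le_mul_of_nonneg_right ((neg_le_abs _).trans hts) q0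
      _ ≤ _ := mul_le_mul_of_nonneg_left q1 (by positivity)
  have b4 : ((t ^ 2 - s ^ 2) * (r - 1)) * (Z * z) ≤ (2 * t * D + D ^ 2) * ε := by
    have q0 : 0 ≤ Z * z := by positivity
    have q1 : Z * z ≤ 1 := mul_le_one₀ hZ1 hz0 hz1
    have q2 : (t ^ 2 - s ^ 2) * (r - 1) ≤ (2 * t * D + D ^ 2) * ε := by
      refine (le_abs_self _).trans ?_
      rw [abs_mul, ← hε]
      exact mul_le_mul_of_nonneg_right hts hε0
    calc ((t ^ 2 - s ^ 2) * (r - 1)) * (Z * z) ≤ ((2 * t * D + D ^ 2) * ε) * (Z * z) :=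
          mul_le_mul_of_nonneg_right q2 q0
      _ ≤ ((2 * t * D + D ^ 2) * ε) * 1 := mul_le_mul_of_nonneg_left q1 (by positivity)
      _ = _ := by ring
  have b5 : -((1 - 1 / r) * (s ^ 2 * Z * (1 - z))) ≤ 2 * ε * (s ^ 2 * g) := by
    have h1z : 0 ≤ 1 - z := by linarith
    have q0 : 0 ≤ s ^ 2 * Z * (1 - z) := by positivity
    have q1 : s ^ 2 * Z * (1 - z) ≤ s ^ 2 * g := by
      rw [mul_assoc]
      apply mul_le_mul_of_nonneg_left _ (sq_nonneg s)
      exact (mul_le_of_le_one_left h1z hZ1).trans h1mz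
    calc -((1 - 1 / r) * (s ^ 2 * Z * (1 - z))) = -(1 - 1 / r) * (s ^ 2 * Z * (1 - z)) := by ring
      _ ≤ (2 * ε) * (s ^ 2 * Z * (1 - z)) :=
          mul_le_mul_of_nonneg_right ((neg_le_abs _).trans hinv) q0
      _ ≤ _ := mul_le_mul_of_nonneg_left q1 (by positivity)
  have b6 : s ^ 2 * Z * z * ρ ≤ s ^ 2 * ρ := by
    apply mul_le_mul_of_nonneg_right _ hρ0
    rw [mul_assoc]
    exact mul_le_of_le_one_right (sq_nonneg s) (mul_le_one₀ hZ1 hz0 hz1)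
  have b5' : 2 * ε * (s ^ 2 * g) ≤ 4 * (t ^ 2 * g * ε) + 2 * D ^ 2 := by
    have q1 : s ^ 2 * (g * ε) ≤ (2 * t ^ 2 + 2 * D ^ 2) * (g * ε) :=
      mul_le_mul_of_nonneg_right hs2 (by positivity)
    have q2 : g * ε ≤ 1 / 2 := (mul_le_of_le_one_left hε0 hg1).trans hnear
    have q3 : D ^ 2 * (g * ε) ≤ D ^ 2 * (1 / 2) := mul_le_mul_of_nonneg_left q2 (sq_nonneg D)
    linarith
  have b3' : (2 * t * D + D ^ 2) * g ≤ 2 * (t * D * g) + D ^ 2 := by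
    linarith [mul_le_of_le_one_right (sq_nonneg D) hg1]
  have b4' : (2 * t * D + D ^ 2) * ε ≤ 2 * (t * D * ε) + D ^ 2 := by
    linarith [mul_le_of_le_one_right (sq_nonneg D) (by linarith : ε ≤ 1)]
  have tot : t ^ 2 * ((1 - Z) * (1 - z)) - (6 * (t ^ 2 * g * ε) + 2 * (t * D * g)
      + 2 * (t * D * ε) + 4 * D ^ 2 + s ^ 2 * ρ)
      ≤ (t ^ 2 - s ^ 2 * Z / r) * (1 - r * z) := by
    rw [ex]; linarith
  have tot2 := mul_le_mul_of_nonneg_left tot (by linarith : 0 ≤ 4 * α)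
  have c0 : t ^ 2 * g ^ 2 ≤ t ^ 2 * (α * ((1 - Z) * (1 - z))) :=
    mul_le_mul_of_nonneg_left b1 (sq_nonneg t)
  have c1 : 24 * α * (t ^ 2 * g * ε) ≤ t ^ 2 * g ^ 2 + 144 * (α ^ 2 * (t ^ 2 * ε ^ 2)) := by
    linarith [sq_nonneg (t * g - 12 * α * (t * ε))]
  have c2 : 8 * α * (t * D * g) ≤ t ^ 2 * g ^ 2 + 16 * (α ^ 2 * D ^ 2) := by
    linarith [sq_nonneg (t * g - 4 * α * D)]
  have hαα : α ≤ α ^ 2 := le_self_pow₀ hα two_ne_zero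
  have c3 : 8 * α * (t * D * ε) ≤ 4 * (α ^ 2 * D ^ 2) + 4 * (α ^ 2 * (t ^ 2 * ε ^ 2)) := by
    have : α * (t * D * ε) ≤ α ^ 2 * (t * D * ε) :=
      mul_le_mul_of_nonneg_right hαα (by positivity)
    linarith [sq_nonneg (α * D - α * (t * ε))]
  have c4 : (t - s * b) ^ 2 ≤ 2 * D ^ 2 + 2 * (t ^ 2 * g ^ 2) := by
    have e : t - s * b = t * g + b * (t - s) := by rw [hg]; ring
    have hb2 : b ^ 2 * (t - s) ^ 2 ≤ (t - s) ^ 2 := by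
      exact mul_le_of_le_one_left (sq_nonneg _) (pow_le_one₀ hb0 hb1)
    rw [e, hD2]
    linarith [sq_nonneg (t * g - b * (t - s)), sq_nonneg (t * g + b * (t - s))]
  have c5 : D ^ 2 ≤ α ^ 2 * D ^ 2 := by
    exact le_mul_of_one_le_left (sq_nonneg D) (hα.trans hαα)
  have c6 : α * D ^ 2 ≤ α ^ 2 * D ^ 2 := mul_le_mul_of_nonneg_right hαα (sq_nonneg D)
  have c7 : α * (s ^ 2 * ρ) ≤ α ^ 2 * (s ^ 2 * ρ) :=
    mul_le_mul_of_nonneg_right hαα (by positivity)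
  have c8 : α ^ 2 * (t ^ 2 * ε ^ 2) ≤ 3 / 2 * (α ^ 2 * (t ^ 2 * ρ)) := by
    have : t ^ 2 * ε ^ 2 ≤ t ^ 2 * (3 / 2 * ρ) := mul_le_mul_of_nonneg_left hερ (sq_nonneg t)
    have := mul_le_mul_of_nonneg_left this (sq_nonneg α)
    linarith
  have p1 : 0 ≤ α ^ 2 * (t ^ 2 * ρ) := by positivity
  have p2 : 0 ≤ α ^ 2 * (s ^ 2 * ρ) := by positivity
  have p3 : 0 ≤ α ^ 2 * D ^ 2 := by positivity
  have goalR : 500 * α ^ 2 * ((t - s) ^ 2 + (s ^ 2 + t ^ 2) / 2 * ρ)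
     = 500 * (α ^ 2 * D ^ 2) + 250 * (α ^ 2 * (s ^ 2 * ρ)) + 250 * (α ^ 2 * (t ^ 2 * ρ)) := by
    rw [hD2]; ring
  rw [goalR]
  linarith

lemma edge_le (α s t p q X Y : ℝ) (hα : 1 ≤ α) (hs : 0 ≤ s) (ht : 0 ≤ t) (hp : 0 < p)
    (hq : 0 < q) (hX : 0 ≤ X) (hXY : X ≤ Y) :
    (t * Y ^ α - s * X ^ α) ^ 2
      - 4 * α * ((t ^ 2 * q * Y ^ (2 * α - 1) - s ^ 2 * p * X ^ (2 * α - 1)) * (Y / q - X / p))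
      ≤ 500 * α ^ 2 * ((X ^ (2 * α) + Y ^ (2 * α)) *
        ((t - s) ^ 2 - (s ^ 2 + t ^ 2) / 2 * ((q - p) * (q⁻¹ - p⁻¹)))) := by
  have hρe : -((q - p) * (q⁻¹ - p⁻¹)) = (q / p - 1) ^ 2 / (q / p) := by
    field_simp; ring
  have hρ0 : 0 ≤ (q / p - 1) ^ 2 / (q / p) := by positivity
  have hR : (t - s) ^ 2 - (s ^ 2 + t ^ 2) / 2 * ((q - p) * (q⁻¹ - p⁻¹))
      = (t - s) ^ 2 + (s ^ 2 + t ^ 2) / 2 * ((q / p - 1) ^ 2 / (q / p)) := by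
    rw [← hρe]; ring
  rw [hR]
  rcases (hX.trans hXY).eq_or_lt with hY | hY
  · have hX0 : X = 0 := le_antisymm (hY ▸ hXY) hX
    rw [← hY, hX0]
    rw [Real.zero_rpow (by linarith), Real.zero_rpow (by linarith), Real.zero_rpow (by linarith)]
    simp
  · obtain ⟨z, hz⟩ : ∃ z, z = X / Y := ⟨_, rfl⟩
    have hXz : X = z * Y := by rw [hz]; field_simp
    have hz0 : 0 ≤ z := by rw [hz]; positivity
    have hz1 : z ≤ 1 := by rw [hz, div_le_one hY]; exact hXY
    have hb1 : z ^ α ≤ 1 := Real.rpow_le_one hz0 hz1 (by linarith)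
    have hbz : z ^ α ≤ z := by
      rcases hz0.eq_or_lt with h | h
      · rw [← h, Real.zero_rpow (by linarith)]
      · simpa using Real.rpow_le_rpow_of_exponent_ge h hz1 hα
    have hZb : z ^ (2 * α - 1) ≤ z ^ α := by
      rcases hz0.eq_or_lt with h | h
      · rw [← h, Real.zero_rpow (by linarith), Real.zero_rpow (by linarith)]
      · exact Real.rpow_le_rpow_of_exponent_ge h hz1 (by linarith)
    have hb2 : (z ^ α) ^ 2 = z ^ (2 * α) := by
      rw [← Real.rpow_natCast, ← Real.rpow_mul hz0]; congr 1; push_cast; ring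
    have hbZ : (z ^ α) ^ 2 ≤ z ^ (2 * α - 1) := by
      rw [hb2]
      rcases hz0.eq_or_lt with h | h
      · rw [← h, Real.zero_rpow (by linarith), Real.zero_rpow (by linarith)]
      · exact Real.rpow_le_rpow_of_exponent_ge h hz1 (by linarith)
    have hber : 1 - z ^ α ≤ α * (1 - z) := by
      have := one_add_mul_self_le_rpow_one_add (s := z - 1) (by linarith) hα
      rw [show 1 + (z - 1) = z by ring] at this
      linarith
    have hZ0 : 0 ≤ z ^ (2 * α - 1) := Real.rpow_nonneg hz0 _
    have hr : 0 < q / p := by positivity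
    have key : (t - s * z ^ α) ^ 2
        - 4 * α * ((t ^ 2 - s ^ 2 * z ^ (2 * α - 1) / (q / p)) * (1 - q / p * z)) ≤
        500 * α ^ 2 * ((t - s) ^ 2 + (s ^ 2 + t ^ 2) / 2 * ((q / p - 1) ^ 2 / (q / p))) := by
      rcases le_or_gt |q / p - 1| (1 / 2) with h | h
      · exact key_near α s t _ z _ _ hα hs ht hr hZ0 hZb hbz hz1 hbZ hber h
      · exact key_far α s t _ z _ _ hα hs ht hr hZ0 hZb hbz hz1 h
    have hY2 : Y ^ (2 * α) = (Y ^ α) ^ 2 := by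
      rw [← Real.rpow_natCast, ← Real.rpow_mul hY.le]; congr 1; push_cast; ring
    have hY1 : Y ^ (2 * α - 1) * Y = Y ^ (2 * α) := by
      rw [← Real.rpow_add_one hY.ne']; congr 1; ring
    have hYp : 0 < Y ^ (2 * α) := Real.rpow_pos_of_pos hY _
    have hXp : 0 ≤ X ^ (2 * α) := Real.rpow_nonneg hX _
    have hL : (t * Y ^ α - s * X ^ α) ^ 2
      - 4 * α * ((t ^ 2 * q * Y ^ (2 * α - 1) - s ^ 2 * p * X ^ (2 * α - 1)) * (Y / q - X / p))
      = Y ^ (2 * α) * ((t - s * z ^ α) ^ 2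
        - 4 * α * ((t ^ 2 - s ^ 2 * z ^ (2 * α - 1) / (q / p)) * (1 - q / p * z))) := by
      have e1 : (t * Y ^ α - s * X ^ α) ^ 2 = Y ^ (2 * α) * (t - s * z ^ α) ^ 2 := by
        rw [hXz, Real.mul_rpow hz0 hY.le, hY2]; ring
      have e2 : (t ^ 2 * q * Y ^ (2 * α - 1) - s ^ 2 * p * X ^ (2 * α - 1)) * (Y / q - X / p)
          = Y ^ (2 * α) *
            ((t ^ 2 - s ^ 2 * z ^ (2 * α - 1) / (q / p)) * (1 - q / p * z)) := by
        rw [hXz, Real.mul_rpow hz0 hY.le, ← hY1]; field_simp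
      rw [e1, e2]; ring
    rw [hL]
    set R := (t - s) ^ 2 + (s ^ 2 + t ^ 2) / 2 * ((q / p - 1) ^ 2 / (q / p)) with hRdef
    have hR0 : 0 ≤ R := by rw [hRdef]; positivity
    have h1 := mul_le_mul_of_nonneg_left key hYp.le
    have h2 : 0 ≤ α ^ 2 * (X ^ (2 * α) * R) := by positivity
    calc _ ≤ _ := h1
      _ ≤ _ := by nlinarith

lemma edge_all (α s t p q X Y : ℝ) (hα : 1 ≤ α) (hs : 0 ≤ s) (ht : 0 ≤ t) (hp : 0 < p)
    (hq : 0 < q) (hX : 0 ≤ X) (hY : 0 ≤ Y) :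
    (t * Y ^ α - s * X ^ α) ^ 2
      - 4 * α * ((t ^ 2 * q * Y ^ (2 * α - 1) - s ^ 2 * p * X ^ (2 * α - 1)) * (Y / q - X / p))
      ≤ 500 * α ^ 2 * ((X ^ (2 * α) + Y ^ (2 * α)) *
        ((t - s) ^ 2 - (s ^ 2 + t ^ 2) / 2 * ((q - p) * (q⁻¹ - p⁻¹)))) := by
  rcases le_total X Y with h | h
  · exact edge_le α s t p q X Y hα hs ht hp hq hX h
  · have := edge_le α t s q p Y X hα ht hs hq hp hY h
    calc _ = _ := by ring
      _ ≤ _ := this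
      _ = _ := by ring

lemma sum_symm_half {d : ℕ} (T : Finset (Vert d)) (F : Vert d → Vert d → ℝ) :
    ∑ x ∈ T, ∑ y ∈ T, F x y = (1 / 2) * ∑ x ∈ T, ∑ y ∈ T, (F x y + F y x) := by
  have : ∑ x ∈ T, ∑ y ∈ T, F y x = ∑ x ∈ T, ∑ y ∈ T, F x y := Finset.sum_comm
  simp only [Finset.sum_add_distrib, this]
  ring

lemma cacc {d : ℕ} (a : Vert d → Vert d → ℝ) (hsym : ∀ x y, a x y = a y x)
    (hpos : ∀ x y, 0 ≤ a x y) (κ : Vert d → ℝ) (hκ : ∀ x, 0 < κ x) (h : ℝ) (h0 : 0 ≤ h) :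
    CaccEst a κ h 500 := by
  intro B hfin _ _ η hη hsupp hbd u hu hLu phi hphi α hα
  set T := hfin.toFinset with hT
  have memT : ∀ x, x ∈ T ↔ x ∈ B := fun x => by simp [hT]
  have hη0 : ∀ x, 0 ≤ η x := fun x => (hη x).1
  have out : ∀ x, x ∉ B → η x = 0 := fun x hx => by
    by_contra hc; exact hx (hsupp x hc)
  -- an edge leaving `T` carries no mass
  have bdry : ∀ x y, adj x y → (x ∉ T ∨ y ∉ T) → a x y = 0 ∨ (η x = 0 ∧ η y = 0) := by
    intro x y hxy hor
    by_cases ha : a x y = 0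
    · exact Or.inl ha
    right
    have hap : 0 < a x y := lt_of_le_of_ne (hpos x y) (Ne.symm ha)
    have hap' : 0 < a y x := hsym x y ▸ hap
    by_cases hx : x ∈ B <;> by_cases hy : y ∈ B
    · rw [memT, memT] at hor; tauto
    · exact ⟨hbd x hx ⟨y, hy, hxy, hap⟩, out y hy⟩
    · exact ⟨out x hx, hbd y hy ⟨x, hx, (adj_symm x y).1 hxy, hap'⟩⟩
    · exact ⟨out x hx, out y hy⟩
  obtain ⟨c, hc⟩ : ∃ c : Vert d → Vert d → ℝ, c = fun x y => if adj x y then a x y else 0 :=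
    ⟨_, rfl⟩
  have c0 : ∀ x y, 0 ≤ c x y := by
    intro x y; rw [hc]; dsimp only; split_ifs; exacts [hpos x y, le_rfl]
  have csymm : ∀ x y, c x y = c y x := by
    intro x y; rw [hc]; dsimp only; rw [hsym x y]; simp only [adj_symm x y]
  obtain ⟨v, hv⟩ : ∃ v : Vert d → ℝ, v = fun x => phi x * u x := ⟨_, rfl⟩
  have hv' : ∀ x, phi x * u x = v x := fun x => by rw [hv]
  have hv0 : ∀ x, 0 ≤ v x := fun x => by rw [hv]; exact mul_nonneg (hphi x).le (hu x)
  have huv : ∀ x, u x = v x / phi x := fun x => by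
    rw [hv]; have := (hphi x).ne'; field_simp
  have cb : ∀ x y, (x ∉ T ∨ y ∉ T) → c x y = 0 ∨ (η x = 0 ∧ η y = 0) := by
    intro x y hor; rw [hc]; dsimp only
    split_ifs with hh
    · exact bdry x y hh hor
    · exact Or.inl rfl
  -- the Dirichlet form
  have hD : dirichletE a κ h (fun x => η x * (phi x * u x) ^ α) =
      (1 / 2) * ∑ x ∈ T, ∑ y ∈ T, c x y * (η y * v y ^ α - η x * v x ^ α) ^ 2
      + h * ∑ x ∈ T, κ x * (η x ^ 2 * v x ^ (2 * α)) := by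
    unfold dirichletE
    simp only [hv']
    congr 2
    · rw [tsum_eq_sum (s := T ×ˢ T)]
      · rw [Finset.sum_product]
        refine Finset.sum_congr rfl fun x _ => Finset.sum_congr rfl fun y _ => ?_
        rw [hc]; dsimp only; split_ifs <;> simp
      · rintro ⟨x, y⟩ hxy
        rw [Finset.mem_product] at hxy
        dsimp only at hxy ⊢
        split_ifs with hh
        · rcases bdry x y hh (by tauto) with h1 | ⟨h1, h2⟩
          · simp [h1]
          · simp [h1, h2]
        · rfl
    · rw [tsum_eq_sum (s := T)]
      · refine Finset.sum_congr rfl fun x _ => ?_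
        have : v x ^ (2 * α) = (v x ^ α) ^ 2 := by
          rw [← Real.rpow_natCast, ← Real.rpow_mul (hv0 x)]; congr 1; push_cast; ring
        rw [this]; ring
      · intro x hx
        rw [memT] at hx
        simp [out x hx]
  -- the right-hand side
  obtain ⟨R, hR⟩ : ∃ R : Vert d → Vert d → ℝ, R = fun x y => (η y - η x) ^ 2
      - (η x ^ 2 + η y ^ 2) / 2 * ((phi y - phi x) * ((phi y)⁻¹ - (phi x)⁻¹)) := ⟨_, rfl⟩
  have Rsymm : ∀ x y, R y x = R x y := by intro x y; rw [hR]; ring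
  have R0 : ∀ x y, η x = 0 → η y = 0 → R x y = 0 := by
    intro x y h1 h2; rw [hR]; simp [h1, h2]
  have hcar : ∀ x, carre a η η x - carreEta a η phi (fun z => (phi z)⁻¹) x
      = ∑ y ∈ T, c x y * R x y := by
    intro x
    unfold carre carreEta
    rw [← Finset.sum_sub_distrib]
    rw [nbrs_sum T]
    · refine Finset.sum_congr rfl fun y _ => ?_
      rw [hc, hR]; dsimp only; split_ifs <;> ring
    · intro y hy hyT
      rcases bdry x y hy (Or.inr hyT) with h1 | ⟨h1, h2⟩
      · simp [h1]
      · simp [h1, h2]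
  have hRHS : ∑' x, (phi x * u x) ^ (2 * α) *
        (carre a η η x - carreEta a η phi (fun z => (phi z)⁻¹) x)
      = (1 / 2) * ∑ x ∈ T, ∑ y ∈ T, c x y * ((v x ^ (2 * α) + v y ^ (2 * α)) * R x y) := by
    simp only [hcar, hv']
    rw [tsum_eq_sum (s := T)]
    · simp only [Finset.mul_sum]
      rw [sum_symm_half]
      simp only [Finset.mul_sum]
      refine Finset.sum_congr rfl fun x _ => Finset.sum_congr rfl fun y _ => ?_
      rw [csymm y x, Rsymm x y]; ring
    · intro x hx
      rw [Finset.sum_eq_zero, mul_zero]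
      intro y _
      rcases cb x y (Or.inl hx) with h1 | ⟨h1, h2⟩
      · simp [h1]
      · simp [R0 x y h1 h2]
  -- testing the equation
  obtain ⟨W, hW⟩ : ∃ W : Vert d → ℝ, W = fun x => η x ^ 2 * phi x * v x ^ (2 * α - 1) := ⟨_, rfl⟩
  have W0 : ∀ x, 0 ≤ W x := by
    intro x; rw [hW]
    exact mul_nonneg (mul_nonneg (sq_nonneg _) (hphi x).le) (Real.rpow_nonneg (hv0 x) _)
  have hWu : ∀ x, W x * u x = η x ^ 2 * v x ^ (2 * α) := by
    intro x
    have e : v x ^ (2 * α - 1) * v x = v x ^ (2 * α) := by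
      rcases (hv0 x).eq_or_lt with hh | hh
      · rw [← hh, Real.zero_rpow (by linarith), Real.zero_rpow (by linarith)]; simp
      · rw [← Real.rpow_add_one hh.ne']; congr 1; ring
    rw [← e, hW]
    have : v x = phi x * u x := (hv' x).symm
    calc _ = η x ^ 2 * (v x ^ (2 * α - 1) * (phi x * u x)) := by ring
      _ = _ := by rw [← this]
  have htest : 0 ≤ ∑ x ∈ T, W x * genL a κ h u x :=
    Finset.sum_nonneg fun x hx => mul_nonneg (W0 x) (hLu x ((memT x).1 hx))
  have hgen : ∑ x ∈ T, W x * genL a κ h u x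
      = -((1 / 2) * ∑ x ∈ T, ∑ y ∈ T, c x y * ((W y - W x) * (u y - u x)))
        - h * ∑ x ∈ T, κ x * (η x ^ 2 * v x ^ (2 * α)) := by
    have e1 : ∀ x ∈ T, W x * genL a κ h u x
        = (∑ y ∈ T, c x y * (W x * (u y - u x))) - h * (κ x * (η x ^ 2 * v x ^ (2 * α))) := by
      intro x _
      unfold genL
      rw [mul_sub, Finset.mul_sum, ← hWu x, nbrs_sum T]
      · congr 1
        · refine Finset.sum_congr rfl fun y _ => ?_
          rw [hc]; dsimp only; split_ifs <;> ring
        · ring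
      · intro y hy hyT
        rcases bdry x y hy (Or.inr hyT) with h1 | ⟨h1, h2⟩
        · simp [h1]
        · simp [hW, h1]
    rw [Finset.sum_congr rfl e1, Finset.sum_sub_distrib, ← Finset.mul_sum]
    congr 1
    rw [sum_symm_half, ← mul_neg, ← Finset.sum_neg_distrib]
    congr 1
    refine Finset.sum_congr rfl fun x _ => ?_
    rw [← Finset.sum_neg_distrib]
    refine Finset.sum_congr rfl fun y _ => ?_
    rw [csymm y x]; ring
  rw [hgen] at htest
  rw [hD, hRHS]
  set H := h * ∑ x ∈ T, κ x * (η x ^ 2 * v x ^ (2 * α)) with hH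
  set J := ∑ x ∈ T, ∑ y ∈ T, c x y * ((W y - W x) * (u y - u x)) with hJ
  have H0 : 0 ≤ H := mul_nonneg h0 (Finset.sum_nonneg fun x _ =>
    mul_nonneg (hκ x).le (mul_nonneg (sq_nonneg _) (Real.rpow_nonneg (hv0 x) _)))
  have hHJ : H ≤ 4 * α * (-(1 / 2 * J)) := by nlinarith
  have hsum : ∑ x ∈ T, ∑ y ∈ T, c x y * (η y * v y ^ α - η x * v x ^ α) ^ 2 - 4 * α * J
      ≤ 500 * α ^ 2 * ∑ x ∈ T, ∑ y ∈ T,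
        c x y * ((v x ^ (2 * α) + v y ^ (2 * α)) * R x y) := by
    rw [hJ, Finset.mul_sum, Finset.mul_sum, ← Finset.sum_sub_distrib]
    refine Finset.sum_le_sum fun x _ => ?_
    rw [Finset.mul_sum, Finset.mul_sum, ← Finset.sum_sub_distrib]
    refine Finset.sum_le_sum fun y _ => ?_
    have := mul_le_mul_of_nonneg_left (edge_all α (η x) (η y) (phi x) (phi y) (v x) (v y) hα
      (hη0 x) (hη0 y) (hphi x) (hphi y) (hv0 x) (hv0 y)) (c0 x y)
    rw [huv x, huv y, hW, hR]
    dsimp only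
    calc _ = _ := by ring
      _ ≤ _ := this
      _ = _ := by ring
  linarith

/-- Lemma `lem:EHI:DF_ualpha`, Caccioppoli-type estimate:
there is an absolute constant `c₃₅` such that for every connected finite
`B ⊆ V`, cut-off `η` vanishing on the internal boundary of `B`, `u ≥ 0` with
`ℒu ≥ 0` on `B`, `φ > 0` and `α ≥ 1`, the Dirichlet form of `η v^α` (with
`v = φ·u`) is bounded by `c₃₅ α² ⟨v^{2α}, Γ(η,η) - Γ_η(φ,φ⁻¹)⟩`. -/
theorem statement16 :
    ∃ c35 : ℝ, 0 < c35 ∧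
      ∀ (d : ℕ), 2 ≤ d →
      ∀ (a : Vert d → Vert d → ℝ), (∀ x y, a x y = a y x) → (∀ x y, 0 ≤ a x y) →
      ∀ κ : Vert d → ℝ, (∀ x, 0 < κ x) → ∀ h ∈ Set.Icc (0:ℝ) 1,
      CaccEst a κ h c35 := by
  refine ⟨500, by norm_num, ?_⟩
  intro d _ a hsym hpos κ hκ h hh
  exact cacc a hsym hpos κ hκ h hh.1

end FPPPaper
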